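/- arXiv:1002.1492 — 4 statements merged into one kernel-verified Lean document; each statement's English description precedes it below -/
import Mathlib

section
/- Fix α ∈ (1/2, 1) and ε > 0. There exists n₀ such that for all n > n₀: every graph G on n vertices with at least ⌊n²/4⌋ + 1 edges in which every edge lies in fewer than αn/2 triangles has at least (α(1−α) − ε)·n²/4 triangles. -/
attribute [local instance] Classical.propDecidable

/-- The size of the book on the edge `uv`: the number of triangles containing it. -/
noncomputable def bookSize {n : ℕ} (G : SimpleGraph (Fin n)) (u v : Fin n) : ℕ :=
  (G.neighborFinset u ∩ G.neighborFinset v).card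

/-- The number of triangles of `G`. -/
noncomputable def triangleCount {n : ℕ} (G : SimpleGraph (Fin n)) : ℕ :=
  (G.cliqueFinset 3).card

namespace SimpleGraph

open Finset

variable {V : Type*} [Fintype V] (G : SimpleGraph V) (c : V → Bool)

/-- The neighbours of `x` with the same colour as `x`. -/
noncomputable def sameNbrs (x : V) : Finset V := {y | G.Adj x y ∧ c y = c x}

/-- The neighbours of `x` with the colour opposite to that of `x`. -/
noncomputable def crossNbrs (x : V) : Finset V := {y | G.Adj x y ∧ c y ≠ c x}

/-- The non-neighbours of `x` with the colour opposite to that of `x`. -/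
noncomputable def crossNonNbrs (x : V) : Finset V := {y | ¬ G.Adj x y ∧ c y ≠ c x}

lemma card_sameNbrs_add_card_crossNbrs (x : V) :
    #(G.sameNbrs c x) + #(G.crossNbrs c x) = G.degree x := by
  rw [← G.card_neighborFinset_eq_degree, G.neighborFinset_eq_filter, sameNbrs, crossNbrs,
    ← filter_filter, ← filter_filter, card_filter_add_card_filter_not]

lemma card_crossNbrs_add_card_crossNonNbrs (x : V) :
    #(G.crossNbrs c x) + #(G.crossNonNbrs c x) = #{y | c y ≠ c x} := by
  rw [← card_filter_add_card_filter_not (s := {y | c y ≠ c x}) (fun y => G.Adj x y),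
    filter_filter, filter_filter]
  simp only [crossNbrs, crossNonNbrs, and_comm]

lemma sum_card_opposite (x : V) :
    ∑ y, (#{z | c z ≠ c y} : ℝ) =
      2 * (#{y | c y ≠ c x} * (Fintype.card V - #{y | c y ≠ c x})) := by
  have hcard : (#{y | c y = c x} : ℝ) = Fintype.card V - #{y | c y ≠ c x} := by
    rw [eq_sub_iff_add_eq]
    exact_mod_cast card_filter_add_card_filter_not (s := univ) (fun y => c y = c x)
  rw [← sum_filter_add_sum_filter_not univ (fun y => c y = c x),
    sum_congr rfl (g := fun _ => (#{y | c y ≠ c x} : ℝ)),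
    sum_congr (s₁ := {y | ¬ c y = c x}) rfl (g := fun _ => (#{y | c y = c x} : ℝ)),
    sum_const, sum_const, nsmul_eq_mul, nsmul_eq_mul, hcard]
  · ring
  · intro y hy
    have hy : c y ≠ c x := by simpa using hy
    congr 3
    ext z
    revert hy
    cases c z <;> cases c y <;> cases c x <;> simp
  · intro y hy
    have hy : c y = c x := by simpa using hy
    rw [hy]

lemma two_mul_sum_card_opposite_le :
    2 * ∑ y, (#{z | c z ≠ c y} : ℝ) ≤ (Fintype.card V : ℝ) ^ 2 := by
  rcases isEmpty_or_nonempty V with _ | ⟨⟨x⟩⟩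
  · simp
  · rw [sum_card_opposite c x]
    nlinarith [sq_nonneg ((Fintype.card V : ℝ) - 2 * #{y | c y ≠ c x})]

lemma card_sameNbrs_eq_sum (x : V) :
    (#(G.sameNbrs c x) : ℝ) = ∑ y, (if G.Adj x y then 1 else 0) *
      ((1 + (if c x then 1 else -1) * (if c y then 1 else -1)) / 2) := by
  rw [sameNbrs, card_filter, Nat.cast_sum]
  refine sum_congr rfl fun y _ => ?_
  by_cases h : G.Adj x y <;> cases hx : c x <;> cases hy : c y <;> simp [h]

lemma card_crossNbrs_eq_sum (x : V) :
    (#(G.crossNbrs c x) : ℝ) = ∑ y, (if G.Adj x y then 1 else 0) *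
      ((1 - (if c x then 1 else -1) * (if c y then 1 else -1)) / 2) := by
  rw [crossNbrs, card_filter, Nat.cast_sum]
  refine sum_congr rfl fun y _ => ?_
  by_cases h : G.Adj x y <;> cases hx : c x <;> cases hy : c y <;> simp [h]

lemma sum_card_sameNbrs_update (x : V) :
    ∑ v, (#(G.sameNbrs (Function.update c x (!c x)) v) : ℝ) =
      ∑ v, (#(G.sameNbrs c v) : ℝ) - 2 * (#(G.sameNbrs c x) - #(G.crossNbrs c x)) := by
  set σ : V → ℝ := fun v => if c v then 1 else -1 with hσ
  have hupd (v : V) : (if Function.update c x (!c x) v then 1 else -1 : ℝ) =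
      σ v - if x = v then 2 * σ x else 0 := by
    by_cases h : v = x
    · subst h; cases hv : c v <;> simp [hσ, hv] <;> norm_num
    · simp [hσ, h, Ne.symm h]
  simp only [card_sameNbrs_eq_sum, card_crossNbrs_eq_sum, hupd]
  change _ = ∑ v, ∑ y, _ * ((1 + σ v * σ y) / 2) - 2 * (∑ y, _ * ((1 + σ x * σ y) / 2) -
    ∑ y, _ * ((1 - σ x * σ y) / 2))
  set a : V → V → ℝ := fun v w => if G.Adj v w then 1 else 0 with ha
  have hsymm (v w : V) : a v w = a w v := by simp [ha, G.adj_comm]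
  have hloop : a x x = 0 := by simp [ha]
  have hterm (v w : V) : a v w * ((1 + (σ v - if x = v then 2 * σ x else 0) *
      (σ w - if x = w then 2 * σ x else 0)) / 2) =
      a v w * ((1 + σ v * σ w) / 2) - (if x = v then a v w * σ x * σ w else 0)
        - (if x = w then a v w * σ x * σ v else 0)
        + (if x = w then (if x = v then 2 * a v w * σ x ^ 2 else 0) else 0) := by
    split_ifs <;> ring
  change ∑ v, ∑ w, a v w * _ = ∑ v, ∑ w, a v w * _ - 2 * (∑ w, a x w * _ - ∑ w, a x w * _)
  simp only [hterm, sum_add_distrib, sum_sub_distrib, sum_ite_eq, mem_univ, if_true]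
  rw [sum_comm (f := fun v w => if x = v then a v w * σ x * σ w else 0)]
  simp only [sum_ite_eq, mem_univ, if_true, hloop]
  have hdiff : ∑ w, a x w * ((1 + σ x * σ w) / 2) - ∑ w, a x w * ((1 - σ x * σ w) / 2) =
      ∑ w, a x w * σ x * σ w := by
    rw [← sum_sub_distrib]
    exact sum_congr rfl fun w _ => by ring
  have hflip : ∑ w, a w x * σ x * σ w = ∑ w, a x w * σ x * σ w :=
    sum_congr rfl fun w _ => by rw [hsymm]
  rw [hdiff, hflip]
  ring

lemma sum_card_sameNbrs_adj :
    ∑ u, ∑ v, (#(G.sameNbrs (fun w => decide (G.Adj u w)) v) : ℝ) =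
      Fintype.card V * ∑ v, (G.degree v : ℝ) - 2 * ∑ v, (G.degree v : ℝ) ^ 2 +
        2 * #{p : V × V × V | G.Adj p.1 p.2.1 ∧ G.Adj p.1 p.2.2 ∧ G.Adj p.2.1 p.2.2} := by
  set a : V → V → ℝ := fun v w => if G.Adj v w then 1 else 0 with ha
  have hsymm (v w : V) : a v w = a w v := by simp [ha, G.adj_comm]
  have hdeg (v : V) : (G.degree v : ℝ) = ∑ w, a v w := by
    rw [← G.card_neighborFinset_eq_degree, G.neighborFinset_eq_filter, card_filter]
    push_cast; rfl
  have htri : (#{p : V × V × V | G.Adj p.1 p.2.1 ∧ G.Adj p.1 p.2.2 ∧ G.Adj p.2.1 p.2.2} : ℝ) =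
      ∑ u, ∑ v, ∑ w, a u v * a u w * a v w := by
    rw [card_filter, Nat.cast_sum, Fintype.sum_prod_type]
    refine sum_congr rfl fun u _ => ?_
    rw [Fintype.sum_prod_type]
    refine sum_congr rfl fun v _ => sum_congr rfl fun w _ => ?_
    simp only [ha, ← ite_and, ite_mul, one_mul, zero_mul, and_assoc]
    push_cast
    rfl
  have hsame (u v : V) : (#(G.sameNbrs (fun w => decide (G.Adj u w)) v) : ℝ) =
      ∑ w, (a v w - a u v * a v w - a u w * a v w + 2 * (a u v * a u w * a v w)) := by
    rw [card_sameNbrs_eq_sum]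
    refine sum_congr rfl fun w _ => ?_
    simp only [ha, decide_eq_true_eq]
    split_ifs <;> norm_num
  have hsq : ∑ v, (G.degree v : ℝ) ^ 2 = ∑ v, ∑ u, ∑ w, a v u * a v w := by
    refine sum_congr rfl fun v _ => ?_
    rw [hdeg, sq, sum_mul_sum]
  have hone : ∑ u, ∑ v, ∑ w, a u v * a v w = ∑ v, (G.degree v : ℝ) ^ 2 := by
    rw [hsq, sum_comm]
    exact sum_congr rfl fun v _ => sum_congr rfl fun u _ => by simp only [hsymm u v]
  have htwo : ∑ u, ∑ v, ∑ w, a u w * a v w = ∑ v, (G.degree v : ℝ) ^ 2 := by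
    rw [← hone]
    refine sum_congr rfl fun u _ => ?_
    rw [sum_comm]
    exact sum_congr rfl fun v _ => sum_congr rfl fun w _ => by rw [hsymm w v]
  simp only [hsame, sum_add_distrib, sum_sub_distrib]
  rw [hone]
  simp only [htwo, ← mul_sum, htri, ← hdeg, sum_const, card_univ, nsmul_eq_mul]
  ring

/-- Ordered triangles are at most `27` times as many as triangles. -/
lemma card_ordered_triangles_le :
    #{p : V × V × V | G.Adj p.1 p.2.1 ∧ G.Adj p.1 p.2.2 ∧ G.Adj p.2.1 p.2.2} ≤
      27 * #(G.cliqueFinset 3) := by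
  refine card_le_mul_card_image_of_maps_to (f := fun p => {p.1, p.2.1, p.2.2}) ?_ 27 ?_
  · rintro ⟨u, v, w⟩ h
    simpa [is3Clique_triple_iff] using h
  · intro s hs
    have hs : #s = 3 := ((mem_cliqueFinset_iff).1 hs).card_eq
    calc _ ≤ #(s ×ˢ s ×ˢ s) := card_le_card ?_
      _ = 27 := by simp [hs]
    rintro ⟨u, v, w⟩ h
    obtain ⟨-, rfl⟩ := mem_filter.1 h
    simp

/-- A graph with at least `n ^ 2 / 4` edges has a locally maximal cut such that the number of edges
inside its two parts is controlled by the number of triangles. -/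
lemma exists_coloring_sum_card_sameNbrs_le
    (hedges : (Fintype.card V : ℝ) ^ 2 ≤ 2 * ∑ v, (G.degree v : ℝ)) :
    ∃ c : V → Bool, (∀ x, #(G.sameNbrs c x) ≤ #(G.crossNbrs c x)) ∧
      Fintype.card V * ∑ x, (#(G.sameNbrs c x) : ℝ) ≤ 54 * #(G.cliqueFinset 3) := by
  obtain ⟨c, hc⟩ := Finite.exists_min (fun c : V → Bool => ∑ x, (#(G.sameNbrs c x) : ℝ))
  refine ⟨c, fun x => ?_, ?_⟩
  · have := hc (Function.update c x (!c x))
    rw [sum_card_sameNbrs_update] at this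
    exact_mod_cast (by linarith : (#(G.sameNbrs c x) : ℝ) ≤ #(G.crossNbrs c x))
  · have hsum := sum_le_sum fun (u : V) (_ : u ∈ univ) => hc (fun w => decide (G.Adj u w))
    rw [sum_card_sameNbrs_adj, sum_const, card_univ, nsmul_eq_mul] at hsum
    have htri : (#{p : V × V × V | G.Adj p.1 p.2.1 ∧ G.Adj p.1 p.2.2 ∧ G.Adj p.2.1 p.2.2} : ℝ) ≤
      27 * #(G.cliqueFinset 3) := by exact_mod_cast G.card_ordered_triangles_le
    have hcs := sq_sum_le_card_mul_sum_sq (s := univ) (f := fun v => (G.degree v : ℝ))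
    rw [card_univ] at hcs
    have hdeg : Fintype.card V * ∑ v, (G.degree v : ℝ) ≤ 2 * ∑ v, (G.degree v : ℝ) ^ 2 := by
      rcases isEmpty_or_nonempty V with _ | _
      · simp
      · have hn : (0 : ℝ) < Fintype.card V := by exact_mod_cast Fintype.card_pos
        have h0 : 0 ≤ ∑ v, (G.degree v : ℝ) := sum_nonneg fun _ _ => by positivity
        refine le_of_mul_le_mul_left ?_ hn
        nlinarith
    linarith

section Relation

variable {r : V → V → Prop} (L : Finset V)

lemma sum_mem_card_filter_eq_left :
    ∑ x ∈ L, #{y | r x y} = ∑ x, ∑ y, if x ∈ L ∧ r x y then 1 else 0 := by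
  rw [← sum_subset (subset_univ L) (fun x _ hx => by simp [hx])]
  refine sum_congr rfl fun x hx => ?_
  simp [hx]

lemma sum_mem_card_filter_eq_right (hr : ∀ x y, r x y ↔ r y x) :
    ∑ x ∈ L, #{y | r x y} = ∑ x, ∑ y, if y ∈ L ∧ r x y then 1 else 0 := by
  rw [sum_mem_card_filter_eq_left, sum_comm]
  simp only [hr]

/-- If all pairs of a symmetric relation meet `L`, they are counted at most twice from `L`. -/
lemma sum_card_filter_le_two_mul (hr : ∀ x y, r x y ↔ r y x)
    (hL : ∀ x y, r x y → x ∈ L ∨ y ∈ L) :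
    ∑ x, #{y | r x y} ≤ 2 * ∑ x ∈ L, #{y | r x y} := by
  rw [two_mul]
  nth_rewrite 2 [sum_mem_card_filter_eq_left]
  rw [sum_mem_card_filter_eq_right L hr, ← sum_add_distrib]
  refine sum_le_sum fun x _ => ?_
  rw [card_filter, ← sum_add_distrib]
  refine sum_le_sum fun y _ => ?_
  grind

/-- Counting a symmetric relation twice from `L` overcounts only pairs inside `L`. -/
lemma two_mul_sum_card_filter_le (hr : ∀ x y, r x y ↔ r y x) :
    2 * ∑ x ∈ L, #{y | r x y} ≤ ∑ x, #{y | r x y} + #L ^ 2 := by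
  have hsq : #L ^ 2 = ∑ x, ∑ y, if x ∈ L ∧ y ∈ L then 1 else 0 := by
    simp [ite_and, sq]
  rw [two_mul, hsq]
  nth_rewrite 1 [sum_mem_card_filter_eq_left]
  rw [sum_mem_card_filter_eq_right L hr, ← sum_add_distrib, ← sum_add_distrib]
  refine sum_le_sum fun x _ => ?_
  rw [card_filter, ← sum_add_distrib, ← sum_add_distrib]
  refine sum_le_sum fun y _ => ?_
  grind

end Relation

/-- The triangles with a vertex `x`, another vertex of the same colour and a third of the
opposite colour. -/
lemma card_sameNbrs_mul_card_crossNbrs_le (x : V) :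
    #(G.sameNbrs c x) * #(G.crossNbrs c x) ≤
      #(G.cliqueFinset 3) + ∑ y, #(G.crossNonNbrs c y) := by
  rw [← card_product,
    ← card_filter_add_card_filter_not (s := G.sameNbrs c x ×ˢ G.crossNbrs c x)
      (fun p => G.Adj p.1 p.2), ← card_sigma]
  refine add_le_add ?_ ?_
  · refine card_le_card_of_injOn (fun p => {x, p.1, p.2}) ?_ ?_
    · rintro ⟨y, z⟩ h
      simp_all [sameNbrs, crossNbrs, is3Clique_triple_iff]
    · rintro ⟨y, z⟩ h ⟨y', z'⟩ h' heq
      simp only [sameNbrs, crossNbrs, coe_filter, mem_product, mem_filter, mem_univ, true_and,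
        Set.mem_ofPred_eq] at h h'
      dsimp only at heq
      have hy : y ∈ ({x, y', z'} : Finset V) := by rw [← heq]; simp
      have hz : z ∈ ({x, y', z'} : Finset V) := by rw [← heq]; simp
      have := h.1.1.1.ne
      have := h.1.2.1.ne
      simp only [mem_insert, mem_singleton] at hy hz
      grind
  · refine card_le_card_of_injOn (fun p => ⟨p.1, p.2⟩) ?_ ?_
    · rintro ⟨y, z⟩ h
      simp_all [sameNbrs, crossNbrs, crossNonNbrs]
    · rintro ⟨y, z⟩ _ ⟨y', z'⟩ _ h
      simpa using h

/-- The common neighbours of `x` and `y` with the colour opposite to theirs. -/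
lemma card_opposite_le {x y : V} (h : c y = c x) :
    #{z | c z ≠ c x} ≤
      #(G.neighborFinset x ∩ G.neighborFinset y) + #(G.crossNonNbrs c x) +
        #(G.crossNonNbrs c y) := by
  refine (card_le_card ?_).trans ((card_union_le _ _).trans
    (add_le_add_left (card_union_le _ _) _))
  intro z hz
  simp only [crossNonNbrs, h, mem_union, mem_inter, mem_neighborFinset, mem_filter, mem_univ,
    true_and] at hz ⊢
  tauto


/-- The optimisation over the size of the missing degree `m` at the heavy vertex. -/
lemma le_mul_of_heavy {α δ N D O m p : ℝ} (hα : α < 1)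
    (hδ : 0 ≤ δ) (hδα : 6 * δ ≤ 1 - α) (hN : 0 ≤ N) (hp : |p - N / 2| ≤ δ * N)
    (hOm : O + m = p) (hDO : D ≤ O) (hD : m - δ * N ≤ D) (hm : p - α * N / 2 - δ * N ≤ m) :
    (α * (1 - α) - 10 * δ) * N ^ 2 / 4 ≤ D * O := by
  obtain ⟨hp₁, hp₂⟩ := abs_le.1 hp
  obtain ⟨s, rfl⟩ : ∃ s, m = s + δ * N := ⟨m - δ * N, by ring⟩
  set s₀ := ((1 - α) / 2 - 3 * δ) * N with hs₀
  have hs₀0 : 0 ≤ s₀ := mul_nonneg (by linarith) hN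
  have hle : s₀ ≤ s := by rw [hs₀]; linarith
  have hs : s ≤ N / 4 := by linarith
  have hO : N / 2 - 2 * δ * N - s ≤ O := by linarith
  have h₁ : s * (N / 2 - 2 * δ * N - s) ≤ D * O :=
    (mul_le_mul_of_nonneg_left hO (by linarith)).trans
      (mul_le_mul_of_nonneg_right (by linarith) (by linarith))
  have h₂ : s₀ * (N / 2 - s₀) ≤ s * (N / 2 - s) := by
    nlinarith [mul_nonneg (sub_nonneg.2 hle) (by linarith : 0 ≤ N / 2 - s - s₀)]
  have h₃ : δ * N * s ≤ δ * N * (N / 4) := mul_le_mul_of_nonneg_left hs (by positivity)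
  have h₄ : (α * (1 - α) - 6 * δ) * N ^ 2 / 4 ≤ s₀ * (N / 2 - s₀) := by
    have : s₀ * (N / 2 - s₀) = ((1 - α - 6 * δ) * (α + 6 * δ)) * N ^ 2 / 4 := by
      rw [hs₀]; ring
    rw [this]
    have : α * (1 - α) - 6 * δ ≤ (1 - α - 6 * δ) * (α + 6 * δ) := by
      nlinarith [mul_nonneg hδ (sub_nonneg.2 hδα), mul_nonneg hδ (sub_nonneg.2 hα.le)]
    gcongr
  have h₅ : 0 ≤ δ * N ^ 2 := by positivity
  linarith

/-- Once `n` is large in terms of `δ` and `ε`, a graph on `n` vertices with more than `n ^ 2 / 4`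
edges in which every edge lies in fewer than `α * n / 2` triangles has at least
`(α * (1 - α) - ε) * n ^ 2 / 4` triangles. -/
lemma le_card_cliqueFinset_of_card_inter_lt {α ε δ : ℝ} (hα : α < 1) (hδ : 0 < δ)
    (hδα : 8 * δ ≤ 1 - α) (hδε : 20 * δ ≤ ε) {n : ℕ} (hn : Fintype.card V = n)
    (hN₁ : 6 ≤ δ ^ 2 * n) (hN₂ : 32 ≤ ε * n)
    (hdeg : (n : ℝ) ^ 2 < 2 * ∑ v, (G.degree v : ℝ))
    (hbook : ∀ u v, G.Adj u v → (#(G.neighborFinset u ∩ G.neighborFinset v) : ℝ) < α * n / 2) :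
    (α * (1 - α) - ε) * n ^ 2 / 4 ≤ #(G.cliqueFinset 3) := by
  by_contra! htri
  have hn0 : (0 : ℝ) < n := by
    by_contra! h
    have := mul_nonpos_of_nonneg_of_nonpos (sq_nonneg δ) h
    linarith
  have htri' : (#(G.cliqueFinset 3) : ℝ) < n ^ 2 / 16 := by
    refine htri.trans_le ?_
    have : α * (1 - α) - ε ≤ 1 / 4 := by nlinarith [sq_nonneg (α - 1 / 2)]
    nlinarith [mul_le_mul_of_nonneg_right this (sq_nonneg (n : ℝ))]
  obtain ⟨c, hcut, hsame⟩ := G.exists_coloring_sum_card_sameNbrs_le (by rw [hn]; exact hdeg.le)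
  rw [hn] at hsame
  replace hsame : ∑ x, (#(G.sameNbrs c x) : ℝ) ≤ 4 * n := by
    refine le_of_mul_le_mul_left (hsame.trans ?_) hn0
    nlinarith
  have hopp (x : V) :
      (#(G.crossNbrs c x) : ℝ) + #(G.crossNonNbrs c x) = #{y | c y ≠ c x} := by
    exact_mod_cast G.card_crossNbrs_add_card_crossNonNbrs c x
  have hsumdeg : ∑ x, (#(G.sameNbrs c x) : ℝ) + ∑ x, (#(G.crossNbrs c x) : ℝ) =
      ∑ v, (G.degree v : ℝ) := by
    rw [← sum_add_distrib]
    exact sum_congr rfl fun x _ => by exact_mod_cast G.card_sameNbrs_add_card_crossNbrs c x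
  have hsumopp : ∑ x, (#(G.crossNbrs c x) : ℝ) + ∑ x, (#(G.crossNonNbrs c x) : ℝ) =
      ∑ x, (#{y | c y ≠ c x} : ℝ) := by
    rw [← sum_add_distrib]
    exact sum_congr rfl fun x _ => hopp x
  have hoppsq := two_mul_sum_card_opposite_le c
  rw [hn] at hoppsq
  have hlt : ∑ x, (#(G.crossNonNbrs c x) : ℝ) < ∑ x, (#(G.sameNbrs c x) : ℝ) := by linarith
  have hbal (x : V) : |(#{y | c y ≠ c x} : ℝ) - n / 2| ≤ δ * n := by
    have h := sum_card_opposite c x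
    have h0 : 0 ≤ ∑ x, (#(G.crossNonNbrs c x) : ℝ) := sum_nonneg fun _ _ => by positivity
    rw [hn] at h
    refine abs_le_of_sq_le_sq ?_ (by positivity)
    nlinarith
  have hbad (x y : V) (hxy : G.Adj x y) (hc : c y = c x) :
      (#{z | c z ≠ c x} : ℝ) - α * n / 2 <
        #(G.crossNonNbrs c x) + #(G.crossNonNbrs c y) := by
    have h₁ : (#{z | c z ≠ c x} : ℝ) ≤
        #(G.neighborFinset x ∩ G.neighborFinset y) + #(G.crossNonNbrs c x) + #(G.crossNonNbrs c y) := by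
      exact_mod_cast G.card_opposite_le c hc
    linarith [hbook x y hxy]
  set L : Finset (V) := {x | δ * n ≤ #(G.crossNonNbrs c x)} with hLdef
  have hcover (x y : V) (hxy : G.Adj x y ∧ c y = c x) : x ∈ L ∨ y ∈ L := by
    by_contra! h
    simp only [hLdef, mem_filter, mem_univ, true_and, not_le] at h
    have := hbad x y hxy.1 hxy.2
    have := (abs_le.1 (hbal x)).1
    nlinarith
  have hsameL : ∑ x, (#(G.sameNbrs c x) : ℝ) ≤ 2 * ∑ x ∈ L, (#(G.sameNbrs c x) : ℝ) := by
    have h : ∑ x, #(G.sameNbrs c x) ≤ 2 * ∑ x ∈ L, #(G.sameNbrs c x) := by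
      convert sum_card_filter_le_two_mul L (r := fun x y => G.Adj x y ∧ c y = c x)
        (fun x y => by rw [G.adj_comm, eq_comm]) hcover <;> unfold sameNbrs <;> congr!
    exact_mod_cast h
  have hmissL : 2 * ∑ x ∈ L, (#(G.crossNonNbrs c x) : ℝ) ≤
      ∑ x, (#(G.crossNonNbrs c x) : ℝ) + (#L : ℝ) ^ 2 := by
    unfold crossNonNbrs
    exact_mod_cast two_mul_sum_card_filter_le L
      (r := fun x y => ¬ G.Adj x y ∧ c y ≠ c x) (fun x y => by rw [G.adj_comm, ne_comm])
  have hcardL : #L * δ ≤ 4 := by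
    have h₁ : #L * (δ * n) ≤ ∑ x ∈ L, (#(G.crossNonNbrs c x) : ℝ) := by
      rw [← nsmul_eq_mul]
      exact card_nsmul_le_sum _ _ _ fun x hx => (mem_filter.1 hx).2
    have h₂ : ∑ x ∈ L, (#(G.crossNonNbrs c x) : ℝ) ≤ ∑ x, (#(G.crossNonNbrs c x) : ℝ) :=
      sum_le_sum_of_subset_of_nonneg (subset_univ _) fun _ _ _ => by positivity
    refine le_of_mul_le_mul_right ?_ hn0
    linarith
  have hL0 : (0 : ℝ) ≤ #L := by positivity
  have hcardL' : 6 * #L ≤ 4 * (δ * n) := by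
    refine le_of_mul_le_mul_right ?_ hδ
    nlinarith
  obtain ⟨x, hxL, hx⟩ : ∃ x ∈ L,
      (#(G.crossNonNbrs c x) : ℝ) - #L / 2 < #(G.sameNbrs c x) := by
    refine exists_lt_of_sum_lt ?_
    rw [sum_sub_distrib, sum_const, nsmul_eq_mul]
    linarith
  have hxδ : δ * n ≤ #(G.crossNonNbrs c x) := (mem_filter.1 hxL).2
  obtain ⟨y, hy, hyL⟩ : ∃ y ∈ G.sameNbrs c x, y ∉ L := by
    refine exists_mem_notMem_of_card_lt_card ?_
    have : (#L : ℝ) < #(G.sameNbrs c x) := by nlinarith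
    exact_mod_cast this
  obtain ⟨hxy, hc⟩ := (mem_filter.1 hy).2
  have hyδ : (#(G.crossNonNbrs c y) : ℝ) < δ * n := by simpa [hLdef] using hyL
  have hD : (#(G.crossNonNbrs c x) : ℝ) - δ * n ≤ #(G.sameNbrs c x) := by linarith
  have hm : (#{z | c z ≠ c x} : ℝ) - α * n / 2 - δ * n ≤ #(G.crossNonNbrs c x) := by
    linarith [hbad x y hxy hc]
  have hprod := le_mul_of_heavy hα hδ.le (by linarith) hn0.le (hbal x) (hopp x)
    (Nat.cast_le.2 (hcut x)) hD hm
  have hcount : (#(G.sameNbrs c x) : ℝ) * #(G.crossNbrs c x) ≤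
      #(G.cliqueFinset 3) + ∑ y, (#(G.crossNonNbrs c y) : ℝ) := by
    exact_mod_cast G.card_sameNbrs_mul_card_crossNbrs_le c x
  have h₁ : δ * (n : ℝ) ^ 2 * 20 ≤ ε * n ^ 2 := by nlinarith [sq_nonneg (n : ℝ)]
  have h₂ : 32 * (n : ℝ) ≤ ε * n ^ 2 := by nlinarith
  linarith

end SimpleGraph

/-- Theorem 1: for `1/2 < α < 1` and `ε > 0`, every sufficiently large graph with at least
`⌊n²/4⌋ + 1` edges and all books of size less than `αn/2` has at least
`(α(1-α) - ε)n²/4` triangles. -/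
theorem books_versus_triangles (α ε : ℝ) (hα₁ : 1 / 2 < α) (hα₂ : α < 1) (hε : 0 < ε) :
    ∃ n₀ : ℕ, ∀ n : ℕ, n₀ < n → ∀ G : SimpleGraph (Fin n),
      n ^ 2 / 4 + 1 ≤ G.edgeFinset.card →
      (∀ u v : Fin n, G.Adj u v → (bookSize G u v : ℝ) < α * n / 2) →
      (α * (1 - α) - ε) * n ^ 2 / 4 ≤ (triangleCount G : ℝ) := by
  obtain ⟨δ, hδ, hδα, hδε⟩ : ∃ δ : ℝ, 0 < δ ∧ 8 * δ ≤ 1 - α ∧ 20 * δ ≤ ε :=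
    ⟨min ((1 - α) / 8) (ε / 20), lt_min (by linarith) (by linarith),
      by linarith [min_le_left ((1 - α) / 8) (ε / 20)],
      by linarith [min_le_right ((1 - α) / 8) (ε / 20)]⟩
  refine ⟨⌈6 / δ ^ 2 + 32 / ε⌉₊, fun n hn G hedges hbook => ?_⟩
  have hN : 6 / δ ^ 2 + 32 / ε < n := (Nat.le_ceil _).trans_lt (by exact_mod_cast hn)
  have hN₁ : 6 ≤ δ ^ 2 * n := by
    rw [mul_comm, ← div_le_iff₀ (by positivity)]
    exact ((le_add_iff_nonneg_right _).2 (by positivity)).trans hN.le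
  have hN₂ : 32 ≤ ε * n := by
    rw [mul_comm, ← div_le_iff₀ (by positivity)]
    exact ((le_add_iff_nonneg_left _).2 (by positivity)).trans hN.le
  have hdeg : (n : ℝ) ^ 2 < 2 * ∑ v, (G.degree v : ℝ) := by
    have h₁ := G.sum_degrees_eq_twice_card_edges
    have h₂ : n ^ 2 < 2 * ∑ v, G.degree v := by rw [h₁]; omega
    exact_mod_cast h₂
  convert G.le_card_cliqueFinset_of_card_inter_lt hα₂ hδ hδα hδε (Fintype.card_fin n) hN₁ hN₂
    ?_ ?_
  · unfold triangleCount
    congr!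
  · convert hdeg
  · intro u v huv
    convert hbook u v huv
    unfold bookSize
    congr!
end

section
/- For every α ∈ (1/3, 1/2) there exists β > 0 such that for all sufficiently large n: every graph G on n vertices with at least ⌊n²/4⌋ + 1 edges and maximum book size b(G) < αn/2 has at least βn³ triangles. -/
attribute [local instance] Classical.propDecidable

open Finset

/-- Comparison of two symmetric weights `a` and `m`: outside a small set `L` every `a`-degree is
small, on `L` the `m`-degrees dominate the `a`-degrees, and every pair in the support of `a` has
large total `m`-degree. Then the total weight of `a` is at most that of `m`. -/
lemma sum_le_sum_of_exceptional_set {V : Type*} [Fintype V] {a m : V → V → ℝ} {N : ℝ}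
    (hN : 0 < N) (ha0 : ∀ u v, 0 ≤ a u v) (hm0 : ∀ u v, 0 ≤ m u v) (hm1 : ∀ u v, m u v ≤ 1)
    (ha : ∀ u v, a u v = a v u) (hm : ∀ u v, m u v = m v u) (L : Finset V)
    (hL : ∀ u ∈ L, ∑ v, a u v + #L ≤ ∑ v, m u v)
    (hL' : ∀ u ∉ L, ∑ v, a u v ≤ N / 8)
    (hsupp : ∀ u v, a u v ≠ 0 → N / 4 + 2 * #L ≤ ∑ w, m u w + ∑ w, m v w) :
    ∑ u, ∑ v, a u v ≤ ∑ u, ∑ v, m u v := by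
  have split (f : V → V → ℝ) (hf : ∀ u v, f u v = f v u) :
      ∑ u, ∑ v, f u v = 2 * ∑ u ∈ L, ∑ v, f u v - ∑ u ∈ L, ∑ v ∈ L, f u v
        + ∑ u ∈ Lᶜ, ∑ v ∈ Lᶜ, f u v := by
    have h1 : ∑ u ∈ Lᶜ, ∑ v, f u v = ∑ u ∈ Lᶜ, ∑ v ∈ L, f u v + ∑ u ∈ Lᶜ, ∑ v ∈ Lᶜ, f u v := by
      rw [← sum_add_distrib]
      exact sum_congr rfl fun u _ ↦ (sum_add_sum_compl L _).symm
    have h2 : ∑ u ∈ L, ∑ v, f u v = ∑ u ∈ L, ∑ v ∈ L, f u v + ∑ u ∈ L, ∑ v ∈ Lᶜ, f u v := by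
      rw [← sum_add_distrib]
      exact sum_congr rfl fun u _ ↦ (sum_add_sum_compl L _).symm
    have h3 : ∑ u ∈ Lᶜ, ∑ v ∈ L, f u v = ∑ u ∈ L, ∑ v ∈ Lᶜ, f u v := by
      rw [sum_comm]
      exact sum_congr rfl fun u _ ↦ sum_congr rfl fun v _ ↦ hf v u
    rw [← sum_add_sum_compl L (fun u ↦ ∑ v, f u v)]
    linarith
  have hLL : ∑ u ∈ L, ∑ v ∈ L, m u v ≤ ∑ u ∈ L, (#L : ℝ) := by
    gcongr with u
    calc ∑ v ∈ L, m u v ≤ ∑ v ∈ L, (1 : ℝ) := sum_le_sum fun v _ ↦ hm1 u v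
      _ = #L := by simp
  have hLa : 0 ≤ ∑ u ∈ L, ∑ v ∈ L, a u v := sum_nonneg fun u _ ↦ sum_nonneg fun v _ ↦ ha0 u v
  have hLm : ∑ u ∈ L, ∑ v, a u v + ∑ u ∈ L, (#L : ℝ) ≤ ∑ u ∈ L, ∑ v, m u v := by
    rw [← sum_add_distrib]
    exact sum_le_sum hL
  have hL0 : 0 ≤ ∑ u ∈ L, (#L : ℝ) := by positivity
  have hdeg (u : V) : ∑ w, m u w ≤ ∑ w ∈ Lᶜ, m u w + #L := by
    rw [← sum_add_sum_compl L]
    have : ∑ v ∈ L, m u v ≤ ∑ v ∈ L, (1 : ℝ) := sum_le_sum fun v _ ↦ hm1 u v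
    simp only [sum_const, nsmul_eq_mul, mul_one] at this
    linarith
  have key : N / 4 * ∑ u ∈ Lᶜ, ∑ v ∈ Lᶜ, a u v ≤ N / 4 * ∑ u ∈ Lᶜ, ∑ v ∈ Lᶜ, m u v := by
    calc N / 4 * ∑ u ∈ Lᶜ, ∑ v ∈ Lᶜ, a u v
        = ∑ u ∈ Lᶜ, ∑ v ∈ Lᶜ, a u v * (N / 4) := by
          simp_rw [mul_sum]
          exact sum_congr rfl fun u _ ↦ sum_congr rfl fun v _ ↦ mul_comm _ _
      _ ≤ ∑ u ∈ Lᶜ, ∑ v ∈ Lᶜ, a u v * (∑ w ∈ Lᶜ, m u w + ∑ w ∈ Lᶜ, m v w) := by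
          refine sum_le_sum fun u _ ↦ sum_le_sum fun v _ ↦ ?_
          by_cases h : a u v = 0
          · simp [h]
          · refine mul_le_mul_of_nonneg_left ?_ (ha0 u v)
            linarith [hsupp u v h, hdeg u, hdeg v]
      _ = 2 * ∑ u ∈ Lᶜ, (∑ v ∈ Lᶜ, a u v) * ∑ w ∈ Lᶜ, m u w := by
          simp_rw [mul_add, sum_add_distrib]
          rw [sum_comm (f := fun u v ↦ a u v * ∑ w ∈ Lᶜ, m v w), two_mul]
          simp_rw [sum_mul]
          congr 1
          exact sum_congr rfl fun u _ ↦ sum_congr rfl fun v _ ↦ by rw [ha]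
      _ ≤ 2 * ∑ u ∈ Lᶜ, N / 8 * ∑ w ∈ Lᶜ, m u w := by
          gcongr with u hu
          · exact sum_nonneg fun w _ ↦ hm0 u w
          · refine le_trans ?_ (hL' u (by simpa using hu))
            exact sum_le_univ_sum_of_nonneg (ha0 u)
      _ = N / 4 * ∑ u ∈ Lᶜ, ∑ v ∈ Lᶜ, m u v := by
          rw [← mul_sum]; ring
  have key' := le_of_mul_le_mul_left key (by positivity)
  rw [split a ha, split m hm]
  linarith

/-- A symmetric weight with zero diagonal has a cut minimizing the weight inside the two sides;
such a cut is in particular locally optimal. -/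
lemma exists_minimal_cut {V : Type*} [Fintype V] (A : V → V → ℝ) (hA : ∀ u v, A u v = A v u)
    (hA0 : ∀ u, A u u = 0) :
    ∃ s : V → ℤˣ, (∀ u, ∑ v, A u v * ((s u : ℤ) * (s v : ℤ) : ℝ) ≤ 0) ∧
      ∀ t : V → ℤˣ, ∑ u, ∑ v, A u v * ((s u : ℤ) * (s v : ℤ) : ℝ)
        ≤ ∑ u, ∑ v, A u v * ((t u : ℤ) * (t v : ℤ) : ℝ) := by
  obtain ⟨s, hs⟩ := Finite.exists_min
    fun t : V → ℤˣ ↦ ∑ u, ∑ v, A u v * ((t u : ℤ) * (t v : ℤ) : ℝ)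
  refine ⟨s, fun u ↦ ?_, hs⟩
  have h := hs (Function.update s u (-s u))
  have e (v w : V) : A v w * (((Function.update s u (-s u) v : ℤˣ) : ℤ) *
      ((Function.update s u (-s u) w : ℤˣ) : ℤ) : ℝ) = A v w * ((s v : ℤ) * (s w : ℤ) : ℝ)
        - (if v = u then 2 * (A u w * ((s u : ℤ) * (s w : ℤ) : ℝ)) else 0)
        - (if w = u then 2 * (A u v * ((s u : ℤ) * (s v : ℤ) : ℝ)) else 0) := by
    by_cases hv : v = u <;> by_cases hw : w = u
    · subst hv; subst hw; simp [hA0]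
    · subst hv; simp [hw]; ring
    · subst hw; simp [hv, hA v w]; ring
    · simp [hv, hw]
  have h2 : ∑ v, ∑ w, (if v = u then 2 * (A u w * ((s u : ℤ) * (s w : ℤ) : ℝ)) else 0)
      = 2 * ∑ w, A u w * ((s u : ℤ) * (s w : ℤ) : ℝ) := by
    rw [sum_comm, mul_sum]
    simp
  have h3 : ∑ v, ∑ w, (if w = u then 2 * (A u v * ((s u : ℤ) * (s v : ℤ) : ℝ)) else 0)
      = 2 * ∑ w, A u w * ((s u : ℤ) * (s w : ℤ) : ℝ) := by
    rw [mul_sum]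
    simp
  simp_rw [e, sum_sub_distrib, h2, h3] at h
  linarith

namespace SimpleGraph

variable {V : Type*} [Fintype V]

lemma sum_adjMatrix_eq_degree (G : SimpleGraph V) (u : V) :
    ∑ v, G.adjMatrix ℝ u v = G.degree u := by
  simp [adjMatrix_apply, ← card_neighborFinset_eq_degree, neighborFinset_eq_filter]

lemma sum_sum_adjMatrix (G : SimpleGraph V) :
    ∑ u, ∑ v, G.adjMatrix ℝ u v = 2 * #G.edgeFinset := by
  simp_rw [sum_adjMatrix_eq_degree]
  exact_mod_cast G.sum_degrees_eq_twice_card_edges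

/-- A triangle-free graph with `e` edges on `n` vertices can be made bipartite by deleting
`n ^ 2 / 4 - e` edges. -/
lemma CliqueFree.exists_cut {H : SimpleGraph V} (hH : H.CliqueFree 3) :
    ∃ s : V → ℤˣ, ∑ u, ∑ v, H.adjMatrix ℝ u v * ((1 + (s u : ℤ) * (s v : ℤ) : ℝ) / 2)
      ≤ (Fintype.card V : ℝ) ^ 2 / 2 - 2 * #H.edgeFinset := by
  rcases isEmpty_or_nonempty V with hV | hV
  · exact ⟨fun _ ↦ 1, by simp [edgeFinset, Subsingleton.elim H ⊥]⟩
  obtain ⟨x, hx⟩ := H.exists_maximal_degree_vertex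
  let p : V → ℝ := fun u ↦ if H.Adj x u then 0 else 1
  refine ⟨fun u ↦ if H.Adj x u then 1 else -1, ?_⟩
  have e1 (u v : V) : H.adjMatrix ℝ u v * ((1 +
      (((if H.Adj x u then 1 else -1 : ℤˣ) : ℤ)) * (((if H.Adj x v then 1 else -1 : ℤˣ) : ℤ)) : ℝ)
        / 2) = p u * H.adjMatrix ℝ u v + p v * H.adjMatrix ℝ u v - H.adjMatrix ℝ u v := by
    by_cases hu : H.Adj x u <;> by_cases hv : H.Adj x v <;> simp [p, hu, hv]
    have huv : ¬ H.Adj u v := fun huv ↦ hH {x, u, v} (is3Clique_triple_iff.2 ⟨hu, hv, huv⟩)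
    simp [huv]
  have e2 : ∑ u, ∑ v, p v * H.adjMatrix ℝ u v = ∑ u, p u * H.degree u := by
    rw [sum_comm]
    simp_rw [← mul_sum, ← sum_adjMatrix_eq_degree]
    simp only [adjMatrix_apply, adj_comm]
  have e3 : ∑ u, p u = Fintype.card V - H.degree x := by
    have (u : V) : p u = 1 - H.adjMatrix ℝ x u := by
      by_cases hu : H.Adj x u <;> simp [p, hu]
    simp_rw [this, sum_sub_distrib, sum_adjMatrix_eq_degree]
    simp
  have e4 : ∑ u, p u * H.degree u ≤ ∑ u, p u * H.degree x := by
    gcongr with u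
    exact hx ▸ H.degree_le_maxDegree u
  rw [← sum_mul, e3] at e4
  simp_rw [e1, sum_sub_distrib, sum_add_distrib, e2, sum_sum_adjMatrix, ← mul_sum,
    sum_adjMatrix_eq_degree]
  nlinarith [sq_nonneg ((Fintype.card V : ℝ) - 2 * H.degree x)]

lemma card_commonNeighbors_eq_sum (G : SimpleGraph V) (u v : V) :
    (#(G.neighborFinset u ∩ G.neighborFinset v) : ℝ)
      = ∑ w, G.adjMatrix ℝ u w * G.adjMatrix ℝ v w := by
  rw [neighborFinset_eq_filter, neighborFinset_eq_filter, ← filter_and]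
  simp [adjMatrix_apply, ← ite_and, and_comm]

/-- A graph with a locally optimal cut `x` that has few edges inside its two sides, and with all
books smaller than `n / 4` by a linear amount, has at most `n ^ 2 / 4` edges. -/
lemma card_edgeFinset_le_of_cut (G : SimpleGraph V) {x : V → ℝ} {n κ η : ℝ}
    (hn : n = Fintype.card V) (hn0 : 0 < n) (hx : ∀ u, x u = 1 ∨ x u = -1)
    (hη0 : 0 < η) (hη : η ≤ 1 / 48) (hκ : 4 * η ≤ κ)
    (hbook : ∀ u v, G.Adj u v →
      (#(G.neighborFinset u ∩ G.neighborFinset v) : ℝ) ≤ n / 4 - κ * n)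
    (hloc : ∀ u, ∑ v, G.adjMatrix ℝ u v * (x u * x v) ≤ 0)
    (hin : ∑ u, ∑ v, G.adjMatrix ℝ u v * ((1 + x u * x v) / 2) ≤ 2 * η ^ 2 * n ^ 2) :
    (#G.edgeFinset : ℝ) ≤ n ^ 2 / 4 := by
  by_contra! he
  let a : V → V → ℝ := fun u v ↦ G.adjMatrix ℝ u v * ((1 + x u * x v) / 2)
  let m : V → V → ℝ := fun u v ↦ (1 - G.adjMatrix ℝ u v) * ((1 - x u * x v) / 2)
  let S : ℝ := ∑ v, x v
  have hA (u v : V) : G.adjMatrix ℝ u v = 0 ∨ G.adjMatrix ℝ u v = 1 := by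
    by_cases h : G.Adj u v <;> simp [h]
  have hAsymm (u v : V) : G.adjMatrix ℝ u v = G.adjMatrix ℝ v u := by
    simp [adjMatrix_apply, adj_comm]
  have ha0 (u v : V) : 0 ≤ a u v := by
    rcases hA u v with h | h <;> rcases hx u with hu | hu <;> rcases hx v with hv | hv <;>
      simp [a, h, hu, hv, -adjMatrix_apply]
  have ha1 (u v : V) : a u v ≤ 1 := by
    rcases hA u v with h | h <;> rcases hx u with hu | hu <;> rcases hx v with hv | hv <;>
      simp [a, h, hu, hv, -adjMatrix_apply]
  have hm0 (u v : V) : 0 ≤ m u v := by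
    rcases hA u v with h | h <;> rcases hx u with hu | hu <;> rcases hx v with hv | hv <;>
      simp [m, h, hu, hv, -adjMatrix_apply]
  have hm1 (u v : V) : m u v ≤ 1 := by
    rcases hA u v with h | h <;> rcases hx u with hu | hu <;> rcases hx v with hv | hv <;>
      simp [m, h, hu, hv, -adjMatrix_apply]
  have ha (u v : V) : a u v = a v u := by simp only [a, hAsymm u v, mul_comm (x u)]
  have hm (u v : V) : m u v = m v u := by simp only [m, hAsymm u v, mul_comm (x u)]
  have hopp (u : V) : ∑ v, (1 - x u * x v) / 2 = (n - x u * S) / 2 := by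
    rw [← sum_div, sum_sub_distrib, ← mul_sum]
    simp [hn, S]
  have hflip (u : V) : ∑ v, a u v + ∑ v, m u v ≤ (n - x u * S) / 2 := by
    have h : ∑ v, a u v + ∑ v, m u v - ∑ v, (1 - x u * x v) / 2
        = ∑ v, G.adjMatrix ℝ u v * (x u * x v) := by
      rw [← sum_add_distrib, ← sum_sub_distrib]
      exact sum_congr rfl fun v _ ↦ by simp only [a, m]; ring
    linarith [hloc u, hopp u]
  have htot : ∑ u, ∑ v, a u v - ∑ u, ∑ v, m u v = 2 * #G.edgeFinset - n ^ 2 / 2 + S ^ 2 / 2 := by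
    have h1 : ∑ u, ∑ v, a u v - ∑ u, ∑ v, m u v
        = ∑ u, ∑ v, G.adjMatrix ℝ u v - ∑ u, ∑ v, (1 - x u * x v) / 2 := by
      simp_rw [← sum_sub_distrib]
      exact sum_congr rfl fun u _ ↦ sum_congr rfl fun v _ ↦ by simp only [a, m]; ring
    have h2 : ∑ u, (n - x u * S) / 2 = (n ^ 2 - S ^ 2) / 2 := by
      rw [← sum_div, sum_sub_distrib, ← sum_mul]
      simp [← hn, S, sq]
    simp_rw [h1, hopp, h2, sum_sum_adjMatrix]
    ring
  have hlt : ∑ u, ∑ v, m u v < ∑ u, ∑ v, a u v := by nlinarith [sq_nonneg S]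
  have hM0 : 0 ≤ ∑ u, ∑ v, m u v := sum_nonneg fun u _ ↦ sum_nonneg fun v _ ↦ hm0 u v
  have hS : |S| ≤ 2 * η * n := by
    refine abs_le_of_sq_le_sq ?_ (by positivity)
    change ∑ u, ∑ v, a u v ≤ _ at hin
    nlinarith
  have hside (u : V) : n / 2 - η * n ≤ (n - x u * S) / 2 := by
    obtain ⟨h1, h2⟩ := abs_le.1 hS
    rcases hx u with hu | hu <;> rw [hu] <;> linarith
  have hpair (u v : V) (huv : a u v ≠ 0) :
      (n - x u * S) / 2 - ∑ w, m u w - ∑ w, m v w ≤ n / 4 - κ * n := by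
    have hadj : G.Adj u v := by
      by_contra h
      simp [a, h] at huv
    have hxx : x u = x v := by
      rcases hx u with hu | hu <;> rcases hx v with hv | hv <;> simp [a, hu, hv] at huv ⊢
    refine le_trans ?_ (hbook u v hadj)
    rw [card_commonNeighbors_eq_sum, ← hopp, ← sum_sub_distrib, ← sum_sub_distrib]
    refine sum_le_sum fun w _ ↦ ?_
    simp only [m, hxx]
    rcases hA u w with h | h <;> rcases hA v w with h' | h' <;> rcases hx v with hv | hv <;>
      rcases hx w with hw | hw <;> norm_num [h, h', hv, hw, -adjMatrix_apply]
  let L : Finset V := {u | n / 8 < ∑ v, a u v}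
  have hLcard : (#L : ℝ) ≤ 16 * η ^ 2 * n := by
    have h1 : ∑ u ∈ L, n / 8 ≤ ∑ u, ∑ v, a u v := by
      refine (sum_le_sum fun u hu ↦ ?_).trans
        (sum_le_univ_sum_of_nonneg fun u ↦ sum_nonneg fun v _ ↦ ha0 u v)
      exact (mem_filter.1 hu).2.le
    rw [sum_const, nsmul_eq_mul] at h1
    have h2 : n * #L ≤ n * (16 * η ^ 2 * n) := by
      change ∑ u, ∑ v, a u v ≤ _ at hin
      nlinarith
    exact le_of_mul_le_mul_left h2 hn0
  have hηn : η ^ 2 * n ≤ η * n / 48 := by nlinarith [mul_pos hη0 hn0]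
  have hκn : 4 * (η * n) ≤ κ * n := by nlinarith
  have hηn0 : 0 < η * n := by positivity
  refine hlt.not_ge (sum_le_sum_of_exceptional_set hn0 ha0 hm0 hm1 ha hm L (fun u hu ↦ ?_)
    (fun u hu ↦ by simpa [L] using hu) fun u v huv ↦ ?_)
  · have hu' : n / 8 < ∑ v, a u v := (mem_filter.1 hu).2
    have hZ : (n - x u * S) / 2 - ∑ w, m u w - (n / 4 - κ * n) ≤ 16 * η ^ 2 * n := by
      by_contra! h
      have h1 : (∑ w, a u w) * ((n - x u * S) / 2 - ∑ w, m u w - (n / 4 - κ * n))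
          ≤ ∑ w, ∑ v, m w v := by
        rw [sum_mul]
        refine sum_le_sum fun w _ ↦ ?_
        have hw0 : 0 ≤ ∑ v, m w v := sum_nonneg fun v _ ↦ hm0 w v
        by_cases h0 : a u w = 0
        · simpa [h0] using hw0
        · refine le_trans (mul_le_mul_of_nonneg_left ?_ (ha0 u w))
            (mul_le_of_le_one_left hw0 (ha1 u w))
          linarith [hpair u w h0]
      have h2 : n / 8 * (16 * η ^ 2 * n)
          < (∑ w, a u w) * ((n - x u * S) / 2 - ∑ w, m u w - (n / 4 - κ * n)) :=
        mul_lt_mul'' hu' h (by positivity) (by positivity)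
      change ∑ u, ∑ v, a u v ≤ _ at hin
      nlinarith
    linarith [hflip u, hside u]
  · linarith [hpair u v huv, hside u]

end SimpleGraph

/-- Theorem 2: for every `α ∈ (1/3, 1/2)` there is `β > 0` such that every sufficiently
large graph with at least `⌊n²/4⌋ + 1` edges and all books of size less than `αn/2`
has at least `βn³` triangles. -/
theorem books_versus_triangles_cubic (α : ℝ) (hα₁ : 1 / 3 < α) (hα₂ : α < 1 / 2) :
    ∃ β : ℝ, 0 < β ∧ ∃ n₀ : ℕ, ∀ n : ℕ, n₀ ≤ n → ∀ G : SimpleGraph (Fin n),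
      n ^ 2 / 4 + 1 ≤ G.edgeFinset.card →
      (∀ u v : Fin n, G.Adj u v → (bookSize G u v : ℝ) < α * n / 2) →
      β * n ^ 3 ≤ (triangleCount G : ℝ) := by
  obtain ⟨η, hη⟩ : ∃ η : ℝ, η = (1 / 4 - α / 2) / 4 := ⟨_, rfl⟩
  have hη0 : 0 < η := by linarith
  refine ⟨SimpleGraph.triangleRemovalBound (η ^ 2 / 2),
    SimpleGraph.triangleRemovalBound_pos (by positivity), 1, fun n hn G he hb ↦ ?_⟩
  by_contra! hT
  have hn0 : (0 : ℝ) < n := by exact_mod_cast hn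
  have he' : (n : ℝ) ^ 2 / 4 < #G.edgeFinset := by
    have h : n ^ 2 < 4 * #G.edgeFinset := by omega
    have h' : (n : ℝ) ^ 2 < 4 * #G.edgeFinset := by exact_mod_cast h
    linarith
  obtain ⟨H, hHG, hcard, hfree⟩ : ∃ H ≤ G,
      (#G.edgeFinset - #H.edgeFinset : ℝ) < η ^ 2 / 2 * n ^ 2 ∧ H.CliqueFree 3 := by
    obtain ⟨H, hHG, _, hcard, hfree⟩ := SimpleGraph.triangle_removal (G := G) (ε := η ^ 2 / 2)
      (by simpa [triangleCount] using hT)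
    rw [Fintype.card_fin, Nat.cast_pow] at hcard
    exact ⟨H, hHG, by convert hcard, hfree⟩
  obtain ⟨t, ht⟩ := hfree.exists_cut
  obtain ⟨s, hloc, hmin⟩ := exists_minimal_cut (G.adjMatrix ℝ)
    (fun u v ↦ by simp [SimpleGraph.adjMatrix_apply, SimpleGraph.adj_comm]) (by simp)
  refine he'.not_ge (G.card_edgeFinset_le_of_cut (x := fun u ↦ ((s u : ℤ) : ℝ)) (η := η)
    (κ := 4 * η) (by simp) hn0 (fun u ↦ ?_) hη0 (by linarith) le_rfl (fun u v huv ↦ ?_) hloc ?_)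
  · rcases Int.units_eq_one_or (s u) with h | h <;> simp [h]
  · have := (hb u v huv).le
    have hα : (n : ℝ) / 4 - 4 * η * n = α * n / 2 := by rw [hη]; ring
    rw [hα]
    refine le_trans (le_of_eq ?_) this
    rw [bookSize]
    congr!
  · have half (r : Fin n → ℤˣ) (F : SimpleGraph (Fin n)) :
        ∑ u, ∑ v, F.adjMatrix ℝ u v * ((1 + (r u : ℤ) * (r v : ℤ) : ℝ) / 2) = #F.edgeFinset
          + (∑ u, ∑ v, F.adjMatrix ℝ u v * ((r u : ℤ) * (r v : ℤ) : ℝ)) / 2 := by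
      have h (u v : Fin n) : F.adjMatrix ℝ u v * ((1 + (r u : ℤ) * (r v : ℤ) : ℝ) / 2)
          = F.adjMatrix ℝ u v / 2 + F.adjMatrix ℝ u v * ((r u : ℤ) * (r v : ℤ) : ℝ) / 2 := by ring
      simp_rw [h, sum_add_distrib, ← sum_div, SimpleGraph.sum_sum_adjMatrix]
      ring
    have hcompare : ∑ u, ∑ v, G.adjMatrix ℝ u v * ((1 + (t u : ℤ) * (t v : ℤ) : ℝ) / 2)
        - ∑ u, ∑ v, H.adjMatrix ℝ u v * ((1 + (t u : ℤ) * (t v : ℤ) : ℝ) / 2)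
        ≤ ∑ u, ∑ v, G.adjMatrix ℝ u v - ∑ u, ∑ v, H.adjMatrix ℝ u v := by
      simp_rw [← sum_sub_distrib, ← sub_mul]
      refine sum_le_sum fun u _ ↦ sum_le_sum fun v _ ↦ mul_le_of_le_one_right ?_ ?_
      · by_cases hH : H.Adj u v
        · simp [hH, hHG hH]
        · by_cases hG : G.Adj u v <;> simp [hH, hG]
      · rcases Int.units_eq_one_or (t u) with h | h <;>
          rcases Int.units_eq_one_or (t v) with h' | h' <;> simp [h, h']
    have hmint := hmin t
    rw [SimpleGraph.sum_sum_adjMatrix, SimpleGraph.sum_sum_adjMatrix, half t G] at hcompare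
    rw [Fintype.card_fin] at ht
    rw [half s G]
    linarith
end

section
/- Every graph on n vertices with at least ⌊n²/4⌋ + 1 edges contains an edge that lies in more than n/6 triangles. -/
open Finset in
/-- A weighted count of triangles may be carried out along any of the three edges. -/
lemma sum_triangles_eq {V : Type*} [Fintype V] (a g : V → V → ℝ) (ha : ∀ u v, a u v = a v u) :
    (∑ u, ∑ v, ∑ w, a u v * a u w * a v w * g u v = ∑ u, ∑ v, a u v * (∑ w, a u w * a v w) * g u v) ∧
    (∑ u, ∑ v, ∑ w, a u v * a u w * a v w * g u w = ∑ u, ∑ v, a u v * (∑ w, a u w * a v w) * g u v) ∧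
    (∑ u, ∑ v, ∑ w, a u v * a u w * a v w * g v w =
      ∑ u, ∑ v, a u v * (∑ w, a u w * a v w) * g u v) := by
  have key : ∑ u, ∑ v, ∑ w, a u v * a u w * a v w * g u v =
      ∑ u, ∑ v, a u v * (∑ w, a u w * a v w) * g u v := by
    refine sum_congr rfl fun u _ => sum_congr rfl fun v _ => ?_
    rw [mul_sum, sum_mul]
    exact sum_congr rfl fun w _ => by ring
  refine ⟨key, ?_, ?_⟩
  · rw [← key]
    refine sum_congr rfl fun u _ => ?_
    rw [sum_comm]
    exact sum_congr rfl fun w _ => sum_congr rfl fun v _ => by rw [ha v w]; ring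
  · rw [← key, sum_comm]
    simp_rw [sum_comm (s := univ (α := V)) (t := univ) (f := fun u w => _ * _ * _ * g _ w)]
    refine sum_congr rfl fun v _ => sum_congr rfl fun w _ => sum_congr rfl fun u _ => ?_
    rw [ha u v, ha u w]; ring

open Finset in
/-- Every vertex sends at most one more edge to a triangle than the number of edges of the
triangle with which it spans a triangle; this is the sum of these bounds over all triangles. -/
lemma sum_codegree_sq_ge {V : Type*} [Fintype V] (a : V → V → ℝ) (ha : ∀ u v, a u v = a v u)
    (h01 : ∀ u v, a u v = 0 ∨ a u v = 1) (c : V → V → ℝ) (hc : ∀ u v, c u v = ∑ w, a u w * a v w)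
    (d : V → ℝ) (hd : ∀ u, d u = ∑ v, a u v) :
    0 ≤ ∑ u, ∑ v, a u v * c u v * (6 * c u v - 3 * d u - 3 * d v + 2 * Fintype.card V) := by
  have h0 : 0 ≤ ∑ u, ∑ v, ∑ w, a u v * a u w * a v w *
      (c u v + c u w + c v w - d u - d v - d w + Fintype.card V) := by
    refine sum_nonneg fun u _ => sum_nonneg fun v _ => sum_nonneg fun w _ => mul_nonneg ?_ ?_
    · rcases h01 u v with h | h <;> rcases h01 u w with h' | h' <;>
        rcases h01 v w with h'' | h'' <;> simp [h, h', h'']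
    · have : c u v + c u w + c v w - d u - d v - d w + Fintype.card V =
          ∑ x, (a u x * a v x + a u x * a w x + a v x * a w x - a u x - a v x - a w x + 1) := by
        simp [hc, hd, sum_add_distrib, sum_sub_distrib]
      rw [this]
      refine sum_nonneg fun x _ => ?_
      rcases h01 u x with h | h <;> rcases h01 v x with h' | h' <;>
        rcases h01 w x with h'' | h'' <;> norm_num [h, h', h'']
  let g : V → V → ℝ := fun u v => 2 * c u v - d u - d v + 2 * Fintype.card V / 3
  obtain ⟨h1, h2, h3⟩ := sum_triangles_eq a g ha
  have h4 : 2 * ∑ u, ∑ v, ∑ w, a u v * a u w * a v w *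
        (c u v + c u w + c v w - d u - d v - d w + Fintype.card V) =
      ∑ u, ∑ v, ∑ w, a u v * a u w * a v w * g u v +
      ∑ u, ∑ v, ∑ w, a u v * a u w * a v w * g u w +
      ∑ u, ∑ v, ∑ w, a u v * a u w * a v w * g v w := by
    simp_rw [mul_sum, ← sum_add_distrib]
    refine sum_congr rfl fun u _ => sum_congr rfl fun v _ => sum_congr rfl fun w _ => ?_
    simp only [g]; ring
  have h5 : ∑ u, ∑ v, a u v * c u v * (6 * c u v - 3 * d u - 3 * d v + 2 * Fintype.card V) =
      3 * ∑ u, ∑ v, a u v * (∑ w, a u w * a v w) * g u v := by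
    simp_rw [mul_sum (s := univ) (a := (3 : ℝ)), ← hc]
    refine sum_congr rfl fun u _ => sum_congr rfl fun v _ => ?_
    simp only [g]; ring
  rw [h1, h2, h3] at h4
  linarith

/-- Edwards' theorem (Erdős' conjecture): every graph on `n` vertices with at least
`⌊n²/4⌋ + 1` edges contains an edge lying in more than `n/6` triangles. -/
theorem edwards_book (n : ℕ) (G : SimpleGraph (Fin n)) [DecidableRel G.Adj]
    (h : n ^ 2 / 4 + 1 ≤ G.edgeFinset.card) :
    ∃ u v : Fin n, G.Adj u v ∧
      (n : ℝ) / 6 < ((G.neighborFinset u ∩ G.neighborFinset v).card : ℝ) := by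
  by_contra! hb
  let a : Fin n → Fin n → ℝ := fun u v => if G.Adj u v then 1 else 0
  let d : Fin n → ℝ := fun u => ∑ v, a u v
  let c : Fin n → Fin n → ℝ := fun u v => ∑ w, a u w * a v w
  have hsymm : ∀ u v, a u v = a v u := fun u v => by simp [a, G.adj_comm]
  have h01 : ∀ u v, a u v = 0 ∨ a u v = 1 := fun u v => by
    by_cases huv : G.Adj u v <;> simp [a, huv]
  have ha0 : ∀ u v, 0 ≤ a u v := fun u v => by rcases h01 u v with h | h <;> simp [h]
  have hc0 : ∀ u v, 0 ≤ c u v := fun u v =>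
    Finset.sum_nonneg fun w _ => mul_nonneg (ha0 _ _) (ha0 _ _)
  have hcodeg : ∀ u v, c u v = ((G.neighborFinset u ∩ G.neighborFinset v).card : ℝ) := fun u v => by
    simp only [c, a, ← ite_and, mul_ite, mul_one, mul_zero]
    rw [Finset.sum_boole]
    congr 2
    ext w
    simp [and_comm]
  have hdeg : ∀ u, d u = G.degree u := fun u => by
    simp only [d, a, Finset.sum_boole, ← G.card_neighborFinset_eq_degree, G.neighborFinset_eq_filter]
  have hedge : ∑ u, d u = 2 * G.edgeFinset.card := by
    simp_rw [hdeg]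
    exact_mod_cast G.sum_degrees_eq_twice_card_edges
  have hlarge : (n : ℝ) ^ 2 < 2 * ∑ u, d u := by
    have : n ^ 2 < 4 * G.edgeFinset.card := by omega
    have : (n : ℝ) ^ 2 < 4 * G.edgeFinset.card := by exact_mod_cast this
    linarith
  have hie : ∀ u v, d u + d v - n ≤ c u v := fun u v => by
    have : c u v - (d u + d v - n) = ∑ x, (1 - a u x) * (1 - a v x) := by
      have : ∀ x, (1 - a u x) * (1 - a v x) = a u x * a v x - a u x - a v x + 1 := fun x => by ring
      simp only [this, Finset.sum_add_distrib, Finset.sum_sub_distrib]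
      simp [c, d]
      ring
    rw [← sub_nonneg, this]
    refine Finset.sum_nonneg fun x _ => ?_
    rcases h01 u x with h | h <;> rcases h01 v x with h' | h' <;> simp [h, h']
  have hmain := sum_codegree_sq_ge a hsymm h01 c (fun _ _ => rfl) d fun _ => rfl
  rw [Fintype.card_fin] at hmain
  have hpt : 0 ≤ ∑ u, ∑ v, a u v * ((n - 6 * c u v) * (2 * c u v - (d u + d v - n))) := by
    refine Finset.sum_nonneg fun u _ => Finset.sum_nonneg fun v _ => ?_
    by_cases huv : G.Adj u v
    · have := hb u v huv
      rw [← hcodeg] at this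
      exact mul_nonneg (ha0 _ _) (mul_nonneg (by linarith) (by linarith [hie u v, hc0 u v]))
    · simp [a, huv]
  have hsplit : ∑ u, ∑ v, a u v * ((n - 6 * c u v) * (2 * c u v - (d u + d v - n))) =
      -(2 * ∑ u, ∑ v, a u v * c u v * (6 * c u v - 3 * d u - 3 * d v + 2 * n)) -
        n * ∑ u, ∑ v, a u v * (d u + d v - n) := by
    simp_rw [Finset.mul_sum, ← Finset.sum_neg_distrib, ← Finset.sum_sub_distrib]
    exact Finset.sum_congr rfl fun u _ => Finset.sum_congr rfl fun v _ => by ring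
  have hsum : ∑ u, ∑ v, a u v * (d u + d v - n) = 2 * ∑ u, d u ^ 2 - n * ∑ u, d u := by
    have h1 : ∑ u, ∑ v, a u v * d u = ∑ u, d u ^ 2 :=
      Finset.sum_congr rfl fun u _ => by rw [← Finset.sum_mul, sq]
    have h2 : ∑ u, ∑ v, a u v * d v = ∑ u, d u ^ 2 := by
      rw [Finset.sum_comm, ← h1]
      simp_rw [hsymm]
    simp_rw [mul_sub, mul_add, Finset.sum_sub_distrib, Finset.sum_add_distrib, h1, h2,
      ← Finset.sum_mul]
    ring
  have hcs : (∑ u, d u) ^ 2 ≤ n * ∑ u, d u ^ 2 := by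
    simpa using sq_sum_le_card_mul_sum_sq (s := Finset.univ) (f := d)
  rw [hsplit, hsum] at hpt
  nlinarith [mul_pos (show 0 < ∑ u, d u by nlinarith [sq_nonneg (n : ℝ)]) (sub_pos.2 hlarge)]
end

section
/- For every α ∈ (1/3, 1/2), the following construction gives a graph G on n vertices with at least n²/4 − O(n) edges, maximum book size at most αn/2 + O(1), and at least (α(1−α)²/16 − o(1))·n³ triangles: partition the vertices into X and Y of sizes ⌊n/2⌋ and ⌈n/2⌉; partition X into X₁, X₂, X₃ and Y into Y₁, Y₂, Y₃ with |X₁|, |Y₁| ≈ αn/2 and |X₂|, |X₃|, |Y₂|, |Y₃| ≈ (1−α)n/4; add all edges between distinct parts within X, all edges between distinct parts within Y, and all edges between Xᵢ and Yᵢ for i = 1,2,3. -/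
attribute [local instance] Classical.propDecidable

/-- The class (`0`, `1` or `2`) of the vertex `i` within its side: each side of the
partition of `Fin n` into `{i < ⌊n/2⌋}` and `{i ≥ ⌊n/2⌋}` is split into three consecutive
intervals of sizes approximately `αn/2`, `(1-α)n/4`, `(1-α)n/4`. -/
noncomputable def thm2Cls (n : ℕ) (α : ℝ) (i : ℕ) : ℕ :=
  let m := n / 2
  let a := ⌊α * n / 2⌋₊
  if i < m then (if i < a then 0 else if i < a + (m - a) / 2 then 1 else 2)
  else (if i < m + a then 0 else if i < m + a + (n - m - a) / 2 then 1 else 2)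

/-- The conjectured extremal graph for Theorem 2: all edges between distinct classes on
the same side, and all edges between equal classes on opposite sides. -/
noncomputable def thm2Example (n : ℕ) (α : ℝ) : SimpleGraph (Fin n) :=
  SimpleGraph.fromRel (fun i j =>
    ((((i : ℕ) < n / 2) ↔ ((j : ℕ) < n / 2)) ∧ thm2Cls n α i ≠ thm2Cls n α j) ∨
    (¬ (((i : ℕ) < n / 2) ↔ ((j : ℕ) < n / 2)) ∧ thm2Cls n α i = thm2Cls n α j))

/-- The vertices of `Fin n` whose values lie in `[l, h)`. -/
def finInterval (n l h : ℕ) : Finset (Fin n) :=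
  Finset.univ.filter fun i => l ≤ (i : ℕ) ∧ (i : ℕ) < h

theorem mem_finInterval {n l h : ℕ} {i : Fin n} :
    i ∈ finInterval n l h ↔ l ≤ (i : ℕ) ∧ (i : ℕ) < h := by
  simp [finInterval]

theorem card_finInterval {n l h : ℕ} (hn : h ≤ n) : (finInterval n l h).card = h - l := by
  have : (finInterval n l h).map Fin.valEmbedding = Finset.Ico l h := by
    ext x
    simp only [Finset.mem_map, mem_finInterval, Fin.valEmbedding_apply, Finset.mem_Ico]
    constructor
    · rintro ⟨i, hi, rfl⟩
      exact hi
    · intro hx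
      exact ⟨⟨x, by omega⟩, hx, rfl⟩
  rw [← Finset.card_map, this, Nat.card_Ico]

theorem disjoint_finInterval {n l h l' h' : ℕ} (hl : h ≤ l') :
    Disjoint (finInterval n l h) (finInterval n l' h') := by
  rw [Finset.disjoint_left]
  intro i hi hi'
  rw [mem_finInterval] at hi hi'
  omega

/-- A vertex together with its class lies in one of six consecutive intervals. -/
theorem thm2Cls_cases {n a : ℕ} {α : ℝ} (ha : ⌊α * n / 2⌋₊ = a) (han : a ≤ n / 2) (i : ℕ) :
    (i < a ∧ i < n / 2 ∧ thm2Cls n α i = 0) ∨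
    (a ≤ i ∧ i < a + (n / 2 - a) / 2 ∧ i < n / 2 ∧ thm2Cls n α i = 1) ∨
    (a + (n / 2 - a) / 2 ≤ i ∧ i < n / 2 ∧ thm2Cls n α i = 2) ∨
    (n / 2 ≤ i ∧ i < n / 2 + a ∧ thm2Cls n α i = 0) ∨
    (n / 2 + a ≤ i ∧ i < n / 2 + a + (n - n / 2 - a) / 2 ∧ thm2Cls n α i = 1) ∨
    (n / 2 + a + (n - n / 2 - a) / 2 ≤ i ∧ thm2Cls n α i = 2) := by
  simp only [thm2Cls, ha]
  split_ifs <;> omega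

theorem thm2Example_adj {n : ℕ} {α : ℝ} {i j : Fin n} :
    (thm2Example n α).Adj i j ↔
      (((i : ℕ) < n / 2) ↔ ((j : ℕ) < n / 2)) ∧ thm2Cls n α i ≠ thm2Cls n α j ∨
      ¬ (((i : ℕ) < n / 2) ↔ ((j : ℕ) < n / 2)) ∧ thm2Cls n α i = thm2Cls n α j := by
  simp only [thm2Example, SimpleGraph.fromRel_adj]
  constructor
  · rintro ⟨-, h | h⟩
    · exact h
    · rwa [iff_comm, ne_comm, eq_comm (a := thm2Cls n α i)]
  · intro h
    refine ⟨?_, Or.inl h⟩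
    rintro rfl
    simp at h

theorem le_degree_of_finInterval {n : ℕ} {G : SimpleGraph (Fin n)} {u : Fin n}
    {l₁ h₁ l₂ h₂ l₃ h₃ : ℕ} (h12 : h₁ ≤ l₂) (h13 : h₁ ≤ l₃) (h23 : h₂ ≤ l₃)
    (hn₁ : h₁ ≤ n) (hn₂ : h₂ ≤ n) (hn₃ : h₃ ≤ n)
    (hG : ∀ v : Fin n, (l₁ ≤ (v : ℕ) ∧ (v : ℕ) < h₁) ∨ (l₂ ≤ (v : ℕ) ∧ (v : ℕ) < h₂) ∨
      (l₃ ≤ (v : ℕ) ∧ (v : ℕ) < h₃) → G.Adj u v) :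
    (h₁ - l₁) + (h₂ - l₂) + (h₃ - l₃) ≤ G.degree u := by
  rw [← card_finInterval hn₁, ← card_finInterval hn₂, ← card_finInterval hn₃,
    ← Finset.card_union_of_disjoint (disjoint_finInterval h12), ← Finset.card_union_of_disjoint
      (Finset.disjoint_union_left.2 ⟨disjoint_finInterval h13, disjoint_finInterval h23⟩),
    ← SimpleGraph.card_neighborFinset_eq_degree]
  refine Finset.card_le_card fun v hv => ?_
  simp only [Finset.mem_union, mem_finInterval] at hv
  rw [SimpleGraph.mem_neighborFinset]
  exact hG v (by tauto)

/-- Every vertex of the construction has degree at least `n / 2 - 2`. -/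
theorem thm2Example_le_degree {n a : ℕ} {α : ℝ} (ha : ⌊α * n / 2⌋₊ = a) (han : a ≤ n / 2)
    (u : Fin n) : n / 2 ≤ (thm2Example n α).degree u + 2 := by
  have hun := u.isLt
  obtain hu | hu | hu | hu | hu | hu := thm2Cls_cases ha han u
  · have := le_degree_of_finInterval (G := thm2Example n α) (u := u) (l₁ := a) (h₁ := n / 2)
      (l₂ := n / 2) (h₂ := n / 2 + a) (l₃ := n) (h₃ := n) (by omega) (by omega) (by omega)
      (by omega) (by omega) (by omega) fun v hv => by
        rw [thm2Example_adj]
        have := thm2Cls_cases ha han v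
        omega
    omega
  · have := le_degree_of_finInterval (G := thm2Example n α) (u := u) (l₁ := 0) (h₁ := a)
      (l₂ := a + (n / 2 - a) / 2) (h₂ := n / 2) (l₃ := n / 2 + a)
      (h₃ := n / 2 + a + (n - n / 2 - a) / 2) (by omega) (by omega) (by omega)
      (by omega) (by omega) (by omega) fun v hv => by
        rw [thm2Example_adj]
        have := thm2Cls_cases ha han v
        omega
    omega
  · have := le_degree_of_finInterval (G := thm2Example n α) (u := u) (l₁ := 0)
      (h₁ := a + (n / 2 - a) / 2) (l₂ := n / 2 + a + (n - n / 2 - a) / 2) (h₂ := n)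
      (l₃ := n) (h₃ := n) (by omega) (by omega) (by omega)
      (by omega) (by omega) (by omega) fun v hv => by
        rw [thm2Example_adj]
        have := thm2Cls_cases ha han v
        omega
    omega
  · have := le_degree_of_finInterval (G := thm2Example n α) (u := u) (l₁ := 0) (h₁ := a)
      (l₂ := n / 2 + a) (h₂ := n) (l₃ := n) (h₃ := n) (by omega) (by omega) (by omega)
      (by omega) (by omega) (by omega) fun v hv => by
        rw [thm2Example_adj]
        have := thm2Cls_cases ha han v
        omega
    omega
  · have := le_degree_of_finInterval (G := thm2Example n α) (u := u) (l₁ := a)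
      (h₁ := a + (n / 2 - a) / 2) (l₂ := n / 2) (h₂ := n / 2 + a)
      (l₃ := n / 2 + a + (n - n / 2 - a) / 2) (h₃ := n) (by omega) (by omega) (by omega)
      (by omega) (by omega) (by omega) fun v hv => by
        rw [thm2Example_adj]
        have := thm2Cls_cases ha han v
        omega
    omega
  · have := le_degree_of_finInterval (G := thm2Example n α) (u := u)
      (l₁ := a + (n / 2 - a) / 2) (h₁ := n / 2) (l₂ := n / 2)
      (h₂ := n / 2 + a + (n - n / 2 - a) / 2) (l₃ := n) (h₃ := n)
      (by omega) (by omega) (by omega) (by omega) (by omega) (by omega) fun v hv => by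
        rw [thm2Example_adj]
        have := thm2Cls_cases ha han v
        omega
    omega

/-- The common neighbours of two adjacent vertices lie in a single class of a single side. -/
theorem thm2Example_card_common_le {n a : ℕ} {α : ℝ} (ha : ⌊α * n / 2⌋₊ = a) (han : a ≤ n / 2)
    (hna : n ≤ 6 * a + 6) {u v : Fin n} (huv : (thm2Example n α).Adj u v) :
    ((thm2Example n α).neighborFinset u ∩ (thm2Example n α).neighborFinset v).card ≤ a + 4 := by
  suffices h : ∃ l h : ℕ, h ≤ n ∧ h ≤ l + a + 4 ∧ ∀ w : Fin n, (thm2Example n α).Adj u w →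
      (thm2Example n α).Adj v w → l ≤ (w : ℕ) ∧ (w : ℕ) < h by
    obtain ⟨l, h, hn, hla, hw⟩ := h
    calc _ ≤ (finInterval n l h).card := Finset.card_le_card fun w hw' => by
            simp only [Finset.mem_inter, SimpleGraph.mem_neighborFinset] at hw'
            exact mem_finInterval.2 (hw w hw'.1 hw'.2)
      _ ≤ a + 4 := by rw [card_finInterval hn]; omega
  rw [thm2Example_adj] at huv
  have hcls : ∀ w : Fin n, thm2Cls n α w ≤ 2 := fun w => by
    have := thm2Cls_cases ha han w
    omega
  have hu := hcls u
  have hv := hcls v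
  simp only [thm2Example_adj]
  by_cases hside : ((u : ℕ) < n / 2 ↔ (v : ℕ) < n / 2)
  · have hne : thm2Cls n α u ≠ thm2Cls n α v := by tauto
    have key : ∀ w : Fin n, _ → _ → ((w : ℕ) < n / 2 ↔ (u : ℕ) < n / 2) ∧
        thm2Cls n α w = 3 - thm2Cls n α u - thm2Cls n α v := fun w
        (h₁ : (((u : ℕ) < n / 2 ↔ (w : ℕ) < n / 2) ∧ thm2Cls n α u ≠ thm2Cls n α w ∨
          ¬((u : ℕ) < n / 2 ↔ (w : ℕ) < n / 2) ∧ thm2Cls n α u = thm2Cls n α w))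
        (h₂ : (((v : ℕ) < n / 2 ↔ (w : ℕ) < n / 2) ∧ thm2Cls n α v ≠ thm2Cls n α w ∨
          ¬((v : ℕ) < n / 2 ↔ (w : ℕ) < n / 2) ∧ thm2Cls n α v = thm2Cls n α w)) => by
      have := hcls w
      omega
    obtain ⟨k, hk, hk2⟩ : ∃ k, k = 3 - thm2Cls n α u - thm2Cls n α v ∧ k ≤ 2 :=
      ⟨_, rfl, by omega⟩
    rw [← hk] at key
    by_cases hum : (u : ℕ) < n / 2
    · interval_cases k
      · refine ⟨0, a, by omega, by omega, fun w h₁ h₂ => ?_⟩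
        have := key w h₁ h₂
        have := thm2Cls_cases ha han w
        omega
      · refine ⟨a, a + (n / 2 - a) / 2, by omega, by omega, fun w h₁ h₂ => ?_⟩
        have := key w h₁ h₂
        have := thm2Cls_cases ha han w
        omega
      · refine ⟨a + (n / 2 - a) / 2, n / 2, by omega, by omega, fun w h₁ h₂ => ?_⟩
        have := key w h₁ h₂
        have := thm2Cls_cases ha han w
        omega
    · interval_cases k
      · refine ⟨n / 2, n / 2 + a, by omega, by omega, fun w h₁ h₂ => ?_⟩
        have := key w h₁ h₂
        have := thm2Cls_cases ha han w
        omega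
      · refine ⟨n / 2 + a, n / 2 + a + (n - n / 2 - a) / 2, by omega, by omega,
          fun w h₁ h₂ => ?_⟩
        have := key w h₁ h₂
        have := thm2Cls_cases ha han w
        omega
      · refine ⟨n / 2 + a + (n - n / 2 - a) / 2, n, by omega, by omega, fun w h₁ h₂ => ?_⟩
        have := key w h₁ h₂
        have := thm2Cls_cases ha han w
        omega
  · refine ⟨0, 0, by omega, by omega, fun w h₁ h₂ => ?_⟩
    omega

/-- Distinct increasing triples of pairwise adjacent vertices span distinct triangles. -/
theorem card_le_card_cliqueFinset_three {n : ℕ} {G : SimpleGraph (Fin n)}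
    (T : Finset (Fin n × Fin n × Fin n))
    (hT : ∀ t ∈ T, t.1 < t.2.1 ∧ t.2.1 < t.2.2 ∧
      G.Adj t.1 t.2.1 ∧ G.Adj t.1 t.2.2 ∧ G.Adj t.2.1 t.2.2) :
    T.card ≤ (G.cliqueFinset 3).card := by
  refine Finset.card_le_card_of_injOn (fun t => {t.1, t.2.1, t.2.2}) (fun t ht => ?_) ?_
  · obtain ⟨-, -, h₁, h₂, h₃⟩ := hT t ht
    simpa [SimpleGraph.is3Clique_triple_iff] using ⟨h₁, h₂, h₃⟩
  · rintro ⟨i, j, k⟩ ht ⟨i', j', k'⟩ ht' heq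
    obtain ⟨h₁, h₂, -⟩ := hT _ ht
    obtain ⟨h₁', h₂', -⟩ := hT _ ht'
    simp only [Finset.ext_iff, Finset.mem_insert, Finset.mem_singleton] at heq
    have e₁ := (heq i).1 (by simp)
    have e₂ := (heq j).1 (by simp)
    have e₃ := (heq k).1 (by simp)
    simp only [Prod.mk.injEq]
    simp only at h₁ h₂ h₁' h₂'
    omega

/-- The triangles contained in one of the two sides. -/
theorem thm2Example_le_card_triangles {n a : ℕ} {α : ℝ} (ha : ⌊α * n / 2⌋₊ = a)
    (han : a ≤ n / 2) :
    a * (((n / 2 - a) / 2) * (n / 2 - a - (n / 2 - a) / 2)) +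
      a * (((n - n / 2 - a) / 2) * (n - n / 2 - a - (n - n / 2 - a) / 2)) ≤
      ((thm2Example n α).cliqueFinset 3).card := by
  have hdisj : Disjoint
      (finInterval n 0 a ×ˢ finInterval n a (a + (n / 2 - a) / 2) ×ˢ
        finInterval n (a + (n / 2 - a) / 2) (n / 2))
      (finInterval n (n / 2) (n / 2 + a) ×ˢ
        finInterval n (n / 2 + a) (n / 2 + a + (n - n / 2 - a) / 2) ×ˢ
        finInterval n (n / 2 + a + (n - n / 2 - a) / 2) n) :=
    Finset.disjoint_product.2 (Or.inl (disjoint_finInterval han))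
  have h := card_le_card_cliqueFinset_three (G := thm2Example n α) (Finset.disjUnion _ _ hdisj)
    fun t ht => by
      simp only [Finset.mem_disjUnion, Finset.mem_product, mem_finInterval] at ht
      simp only [thm2Example_adj, Fin.lt_def]
      have h₁ := thm2Cls_cases ha han t.1
      have h₂ := thm2Cls_cases ha han t.2.1
      have h₃ := thm2Cls_cases ha han t.2.2
      rcases ht with ht | ht
      · have : thm2Cls n α t.1 = 0 := by omega
        have : thm2Cls n α t.2.1 = 1 := by omega
        have : thm2Cls n α t.2.2 = 2 := by omega
        omega
      · have : thm2Cls n α t.1 = 0 := by omega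
        have : thm2Cls n α t.2.1 = 1 := by omega
        have : thm2Cls n α t.2.2 = 2 := by omega
        omega
  rw [Finset.card_disjUnion] at h
  simp only [Finset.card_product] at h
  rw [card_finInterval (by omega), card_finInterval (by omega), card_finInterval (by omega),
    card_finInterval (by omega), card_finInterval (by omega), card_finInterval (by omega)] at h
  convert h using 4 <;> omega

/-- For `α ∈ (1/3, 1/2)`, the construction has `n²/4 - O(n)` edges, maximum book size at
most `αn/2 + O(1)`, and at least `(α(1-α)²/16 - o(1))n³` triangles. -/
theorem thm2_example_properties (α : ℝ) (hα₁ : 1 / 3 < α) (hα₂ : α < 1 / 2) :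
    ∃ C : ℝ, 0 < C ∧ ∃ n₀ : ℕ, ∀ n : ℕ, n₀ ≤ n →
      ((n : ℝ) ^ 2 / 4 - C * n ≤ ((thm2Example n α).edgeFinset.card : ℝ)) ∧
      (∀ u v : Fin n, (thm2Example n α).Adj u v →
        (((thm2Example n α).neighborFinset u ∩
          (thm2Example n α).neighborFinset v).card : ℝ) ≤ α * n / 2 + C) ∧
      (α * (1 - α) ^ 2 / 16 * n ^ 3 - C * n ^ 2 ≤
        (((thm2Example n α).cliqueFinset 3).card : ℝ)) := by
  refine ⟨10, by norm_num, 10, fun n hn => ?_⟩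
  obtain ⟨a, ha⟩ : ∃ a, ⌊α * n / 2⌋₊ = a := ⟨_, rfl⟩
  have hn' : (10 : ℝ) ≤ n := by exact_mod_cast hn
  have ha₁ : (a : ℝ) ≤ α * n / 2 := ha ▸ Nat.floor_le (by positivity)
  have ha₂ : α * n / 2 < a + 1 := ha ▸ Nat.lt_floor_add_one _
  have han : a ≤ n / 2 := by
    have : (4 * a : ℝ) ≤ n := by nlinarith
    have : 4 * a ≤ n := by exact_mod_cast this
    omega
  have hna : n ≤ 6 * a + 6 := by
    have : (n : ℝ) ≤ 6 * a + 6 := by nlinarith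
    exact_mod_cast this
  refine ⟨?_, fun u v huv => ?_, ?_⟩
  · have hsum : n * (n / 2) ≤ 2 * (thm2Example n α).edgeFinset.card + n * 2 := by
      have := Finset.sum_le_sum fun u (_ : u ∈ Finset.univ) =>
        thm2Example_le_degree (α := α) ha han u
      rw [Finset.sum_add_distrib, SimpleGraph.sum_degrees_eq_twice_card_edges] at this
      simpa using this
    have hm : (n : ℝ) ≤ 2 * (n / 2 : ℕ) + 1 := by
      have : n ≤ 2 * (n / 2) + 1 := by omega
      exact_mod_cast this
    have hsum' : (n : ℝ) * (n / 2 : ℕ) ≤ 2 * (thm2Example n α).edgeFinset.card + n * 2 := by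
      exact_mod_cast hsum
    nlinarith
  · have : (((thm2Example n α).neighborFinset u ∩
        (thm2Example n α).neighborFinset v).card : ℝ) ≤ a + 4 := by
      exact_mod_cast thm2Example_card_common_le ha han hna huv
    linarith
  · have htri := thm2Example_le_card_triangles (α := α) ha han
    obtain ⟨A, hA⟩ : ∃ A, α * n / 2 = A := ⟨_, rfl⟩
    obtain ⟨B, hB⟩ : ∃ B, (1 - α) * n / 4 = B := ⟨_, rfl⟩
    have hA₁ : 1 ≤ A := by nlinarith
    have hA₂ : A ≤ n := by nlinarith
    have hB₁ : 1 ≤ B := by nlinarith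
    have hB₂ : B ≤ n := by nlinarith
    have hsize : ∀ p : ℕ, n ≤ 2 * a + 4 * p + 3 → B - 1 ≤ p := fun p hp => by
      have : (n : ℝ) ≤ 2 * a + 4 * p + 3 := by exact_mod_cast hp
      linarith
    have hprod : ∀ p q : ℕ, n ≤ 2 * a + 4 * p + 3 → n ≤ 2 * a + 4 * q + 3 →
        (A - 1) * ((B - 1) * (B - 1)) ≤ ((a * (p * q) : ℕ) : ℝ) := fun p q hp hq => by
      push_cast
      have := hsize p hp
      have := hsize q hq
      have : A - 1 ≤ a := by linarith
      gcongr
    have h₁ := hprod ((n / 2 - a) / 2) (n / 2 - a - (n / 2 - a) / 2) (by omega) (by omega)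
    have h₂ := hprod ((n - n / 2 - a) / 2) (n - n / 2 - a - (n - n / 2 - a) / 2)
      (by omega) (by omega)
    have h₃ := add_le_add h₁ h₂
    rw [← Nat.cast_add] at h₃
    refine le_trans ?_ (h₃.trans (Nat.cast_le.2 htri))
    have hmain : α * (1 - α) ^ 2 / 16 * (n : ℝ) ^ 3 = 2 * (A * B ^ 2) := by
      rw [← hA, ← hB]
      ring
    rw [hmain]
    have hBB : B * B ≤ n * n := by gcongr
    have hAB : A * B ≤ n * n := by gcongr
    nlinarith
end
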